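/- Assume g satisfies conditions (2.4) and h satisfies conditions (2.5), and let N ≥ 1 be an integer. Let 0 ≤ t₀ < a and let φ be a C¹ function on (t₀, a], continuous at t₀, with φ(t₀) = 0, φ(t) > 0 and φ'(t) ≥ 0 on (t₀, a], solving the ODE (t^{N−1} g(φ(t)²) φ(t))' = t^{N−1} h(φ(t)²) on (t₀, a]. Then for every t ∈ (t₀, a] one has t^{N−1} g(φ(t)²) φ(t) ≤ (t^N/N) h(φ(t)²), and consequently G(φ(t)²) φ'(t) ≥ (1/N) h(φ(t)²). -/

import Mathlib

open Set Filter

noncomputable section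

/-- `G(ξ) = g(ξ) + 2ξ g'(ξ)`, from (1.2). -/
def Gfun (g : ℝ → ℝ) (ξ : ℝ) : ℝ := g ξ + 2 * ξ * deriv g ξ

/-- Conditions (2.4) on `g`. -/
def Cond24 (g : ℝ → ℝ) : Prop :=
  ContDiffOn ℝ (⊤ : ℕ∞) g (Ioi 0) ∧ (∀ ξ > (0:ℝ), 0 < g ξ) ∧
  Tendsto (fun ξ : ℝ => g (ξ ^ 2) * ξ) (nhdsWithin 0 (Ioi 0)) (nhds 0) ∧
  Tendsto (fun ξ : ℝ => g (ξ ^ 2) * ξ) atTop atTop ∧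
  (∀ ξ > (0:ℝ), 0 < Gfun g ξ)

/-- Conditions (2.5) on `h`. -/
def Cond25 (h : ℝ → ℝ) : Prop :=
  ContDiffOn ℝ (⊤ : ℕ∞) h (Ici 0) ∧ (∀ ξ ≥ (0:ℝ), 0 < h ξ) ∧
  (∀ ξ ≥ (0:ℝ), 0 ≤ derivWithin h (Ici 0) ξ)

/-- A function on `[0, ∞)` satisfying `Cond25` is monotone there. -/
theorem Cond25.monotoneOn {h : ℝ → ℝ} (hh : Cond25 h) : MonotoneOn h (Ici 0) := by
  obtain ⟨hsmooth, -, hderiv⟩ := hh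
  refine monotoneOn_of_deriv_nonneg (convex_Ici 0) hsmooth.continuousOn ?_ ?_
  · exact (hsmooth.differentiableOn (by simp)).mono interior_subset
  · intro x hx
    rw [← derivWithin_of_mem_nhds (mem_interior_iff_mem_nhds.1 hx)]
    exact hderiv x (interior_subset hx)

/-- Chain rule for `g(φ²) φ`, whose derivative is `G(φ²) φ'`. -/
theorem Cond24.hasDerivWithinAt_comp {g φ : ℝ → ℝ} {s : Set ℝ} {t d : ℝ} (hg : Cond24 g)
    (hφ : HasDerivWithinAt φ d s t) (hpos : 0 < φ t) :
    HasDerivWithinAt (fun τ => g (φ τ ^ 2) * φ τ) (Gfun g (φ t ^ 2) * d) s t := by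
  have hsq : 0 < φ t ^ 2 := by positivity
  have hgd : HasDerivAt g (deriv g (φ t ^ 2)) (φ t ^ 2) :=
    ((hg.1.differentiableOn (by simp)).differentiableAt (Ioi_mem_nhds hsq)).hasDerivAt
  have hcomp : HasDerivWithinAt (fun τ => g (φ τ ^ 2)) (deriv g (φ t ^ 2) * _) s t :=
    hgd.comp_hasDerivWithinAt t (hφ.pow 2)
  refine (hcomp.mul hφ).congr_deriv ?_
  simp only [Gfun]
  push_cast
  ring

/-- A positive function tending to `0` makes `g(φ²) φ` tend to `0`. -/
theorem Cond24.tendsto_comp {g φ : ℝ → ℝ} {t₀ a : ℝ} (hg : Cond24 g) (hta : t₀ < a)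
    (hφcont : ContinuousWithinAt φ (Icc t₀ a) t₀) (hinit : φ t₀ = 0)
    (hφpos : ∀ t ∈ Ioc t₀ a, 0 < φ t) :
    Tendsto (fun τ => g (φ τ ^ 2) * φ τ) (nhdsWithin t₀ (Ioi t₀)) (nhds 0) := by
  refine hg.2.2.1.comp (tendsto_nhdsWithin_iff.2 ⟨?_, ?_⟩)
  · rw [← nhdsWithin_Ioc_eq_nhdsGT hta, ← hinit]
    exact hφcont.mono Ioc_subset_Icc_self
  · filter_upwards [Ioc_mem_nhdsGT hta] with s hs using hφpos s hs

/-- A function vanishing at the right of `t₀ ≥ 0` whose derivative is at most `C τᴺ⁻¹` on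
`(t₀, t]` is at most `C tᴺ / N` at `t`. -/
theorem le_pow_div_mul_of_hasDerivWithinAt_le {N : ℕ} (hN : 1 ≤ N) {F F' : ℝ → ℝ} {t₀ t C : ℝ}
    (ht₀ : 0 ≤ t₀) (ht : t₀ < t) (hC : 0 ≤ C)
    (hF : ∀ s ∈ Ioc t₀ t, HasDerivWithinAt F (F' s) (Ioc t₀ t) s)
    (hF' : ∀ s ∈ Ioc t₀ t, F' s ≤ s ^ (N - 1) * C)
    (hlim : Tendsto F (nhdsWithin t₀ (Ioi t₀)) (nhds 0)) :
    F t ≤ t ^ N / N * C := by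
  have hN0 : (N : ℝ) ≠ 0 := by positivity
  have hd : ∀ s ∈ Ioc t₀ t, HasDerivWithinAt (fun τ => F τ - τ ^ N / N * C)
      (F' s - s ^ (N - 1) * C) (Ioc t₀ t) s := by
    intro s hs
    refine ((hF s hs).sub
      (((hasDerivAt_pow N s).hasDerivWithinAt.div_const (N : ℝ)).mul_const C)).congr_deriv ?_
    field_simp
  have hanti : AntitoneOn (fun τ => F τ - τ ^ N / N * C) (Ioc t₀ t) :=
    antitoneOn_of_hasDerivWithinAt_nonpos (convex_Ioc t₀ t)
      (fun s hs => (hd s hs).continuousWithinAt)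
      (fun s hs => (hd s (interior_subset hs)).mono interior_subset)
      (fun s hs => sub_nonpos.2 (hF' s (interior_subset hs)))
  have hpoly : Tendsto (fun τ : ℝ => τ ^ N / N * C) (nhdsWithin t₀ (Ioi t₀))
      (nhds (t₀ ^ N / N * C)) :=
    (Continuous.tendsto (by fun_prop) t₀).mono_left nhdsWithin_le_nhds
  have hle : F t - t ^ N / N * C ≤ 0 - t₀ ^ N / N * C := by
    refine ge_of_tendsto (hlim.sub hpoly) ?_
    filter_upwards [Ioc_mem_nhdsGT ht] with s hs
    exact hanti hs (right_mem_Ioc.2 ht) hs.2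
  have hnonneg : 0 ≤ t₀ ^ N / N * C := by positivity
  linarith

/-- Claims (2.7)–(2.8) in the proof of the paper's Lemma 2.3: if `φ` is a `C¹`
solution of `(t^{N−1} g(φ²) φ)' = t^{N−1} h(φ²)` on `(t₀, a]`, continuous at `t₀`
with `φ(t₀) = 0`, and `φ > 0`, `φ' ≥ 0` on `(t₀, a]`, then for all `t ∈ (t₀, a]`
one has `t^{N−1} g(φ²) φ ≤ (tᴺ/N) h(φ²)` and `G(φ²) φ' ≥ (1/N) h(φ²)`. -/
theorem stmt5 (N : ℕ) (hN : 1 ≤ N) (g h : ℝ → ℝ) (hg : Cond24 g) (hh : Cond25 h)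
    (t₀ a : ℝ) (ht₀ : 0 ≤ t₀) (hta : t₀ < a)
    (φ φ' : ℝ → ℝ)
    (hφderiv : ∀ t ∈ Ioc t₀ a, HasDerivWithinAt φ (φ' t) (Ioc t₀ a) t)
    (hφ'cont : ContinuousOn φ' (Ioc t₀ a))
    (hφcont : ContinuousWithinAt φ (Icc t₀ a) t₀)
    (hinit : φ t₀ = 0)
    (hφpos : ∀ t ∈ Ioc t₀ a, 0 < φ t)
    (hφ'nonneg : ∀ t ∈ Ioc t₀ a, 0 ≤ φ' t)
    (hode : ∀ t ∈ Ioc t₀ a,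
      HasDerivWithinAt (fun τ : ℝ => τ ^ (N - 1) * (g (φ τ ^ 2) * φ τ))
        (t ^ (N - 1) * h (φ t ^ 2)) (Ioc t₀ a) t) :
    ∀ t ∈ Ioc t₀ a,
      t ^ (N - 1) * (g (φ t ^ 2) * φ t) ≤ t ^ N / N * h (φ t ^ 2) ∧
      (1 / N : ℝ) * h (φ t ^ 2) ≤ Gfun g (φ t ^ 2) * φ' t := by
  have hφmono : MonotoneOn φ (Ioc t₀ a) :=
    monotoneOn_of_hasDerivWithinAt_nonneg (convex_Ioc t₀ a)
      (fun s hs => (hφderiv s hs).continuousWithinAt)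
      (fun s hs => (hφderiv s (interior_subset hs)).mono interior_subset)
      (fun s hs => hφ'nonneg s (interior_subset hs))
  intro t ht
  have htpos : 0 < t := ht₀.trans_lt ht.1
  have hsub : Ioc t₀ t ⊆ Ioc t₀ a := Ioc_subset_Ioc_right ht.2
  have hbound : t ^ (N - 1) * (g (φ t ^ 2) * φ t) ≤ t ^ N / N * h (φ t ^ 2) := by
    refine le_pow_div_mul_of_hasDerivWithinAt_le hN ht₀ ht.1 (hh.2.1 _ (sq_nonneg _)).le
      (fun s hs => (hode s (hsub hs)).mono hsub) (fun s hs => ?_) ?_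
    · have hs0 : 0 ≤ s := ht₀.trans hs.1.le
      have hφs : φ s ≤ φ t := hφmono (hsub hs) ht hs.2
      have := hh.monotoneOn (sq_nonneg (φ s)) (sq_nonneg (φ t))
        (pow_le_pow_left₀ (hφpos s (hsub hs)).le hφs 2)
      gcongr
    · have hpow : Tendsto (fun τ : ℝ => τ ^ (N - 1)) (nhdsWithin t₀ (Ioi t₀))
          (nhds (t₀ ^ (N - 1))) :=
        (Continuous.tendsto (by fun_prop) t₀).mono_left nhdsWithin_le_nhds
      simpa using hpow.mul (hg.tendsto_comp hta hφcont hinit hφpos)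
  refine ⟨hbound, ?_⟩
  have hprod := (hasDerivAt_pow (N - 1) t).hasDerivWithinAt.mul
    (hg.hasDerivWithinAt_comp (hφderiv t ht) (hφpos t ht))
  have heq := (uniqueDiffOn_Ioc t₀ a t ht).eq_deriv _ (hode t ht) hprod
  obtain ⟨n, rfl⟩ : ∃ n, N = n + 1 := ⟨N - 1, by omega⟩
  simp only [Nat.add_sub_cancel] at heq hbound
  set u := g (φ t ^ 2) * φ t
  set v := Gfun g (φ t ^ 2) * φ' t
  set H := h (φ t ^ 2)
  have hpow : (n : ℝ) * t ^ (n - 1) * t = n * t ^ n := by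
    cases n with
    | zero => simp
    | succ k => simp [pow_succ, mul_assoc]
  have hmul : t ^ n * (t * H) = t ^ n * (n * u + t * v) := by
    linear_combination t * heq + u * hpow
  have hode' : t * H = n * u + t * v := mul_left_cancel₀ (by positivity) hmul
  have hu : u ≤ t / (n + 1 : ℕ) * H := by
    refine le_of_mul_le_mul_left (hbound.trans_eq ?_) (pow_pos htpos n)
    ring
  refine le_of_mul_le_mul_left ?_ htpos
  have hnu := mul_le_mul_of_nonneg_left hu (Nat.cast_nonneg (α := ℝ) n)
  have hsplit : t * (1 / (n + 1 : ℕ) * H) + n * (t / (n + 1 : ℕ) * H) = t * H := by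
    push_cast
    field_simp
    ring
  linarith

end
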